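/- (Kučera) Let Z be a Martin-Löf random Δ⁰₂ set. Then there is a computably enumerable set A that is not computable such that A ≤_T Z. -/

import Mathlib

/-! Basic definitions: Cantor space, initial segments, computable approximations,
Martin-Löf randomness, change counting, cost functions, oracle computability. -/

/-- The length-`n` initial segment of `Z : ℕ → Bool`, as a list of booleans. -/
def restr (Z : ℕ → Bool) (n : ℕ) : List Bool := (List.range n).map Z

/-- `σ` is an initial segment of `Z`. -/
def InitSeg (σ : List Bool) (Z : ℕ → Bool) : Prop := σ = restr Z σ.length

/-- `Z` is Martin-Löf random: for every computable sequence of strings with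
finite total measure, only finitely many are initial segments of `Z`. -/
def MLRandom (Z : ℕ → Bool) : Prop :=
  ∀ σ : ℕ → List Bool, Computable σ →
    Summable (fun i => ((1 : ℝ) / 2) ^ (σ i).length) →
    {i | InitSeg (σ i) Z}.Finite

/-- `(Zs s) s∈ℕ` converges pointwise to `Z`. -/
def Approx (Zs : ℕ → ℕ → Bool) (Z : ℕ → Bool) : Prop :=
  ∀ x, ∃ t, ∀ s, t ≤ s → Zs s x = Z x

/-- `Zs` is a computable approximation of `Z`. -/
def CompApprox (Zs : ℕ → ℕ → Bool) (Z : ℕ → Bool) : Prop :=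
  Computable₂ Zs ∧ Approx Zs Z

/-- `Z` is Δ⁰₂: it has a computable approximation. -/
def Delta02 (Z : ℕ → Bool) : Prop := ∃ Zs, CompApprox Zs Z

/-- The set of stages `s ≥ 1` at which the length-`n` initial segment of the
approximation changes. -/
def changeStages (Zs : ℕ → ℕ → Bool) (n : ℕ) : Set ℕ :=
  {s | 1 ≤ s ∧ restr (Zs s) n ≠ restr (Zs (s - 1)) n}

/-- `Z` is a `g`-change set. -/
def GChangeSet (Z : ℕ → Bool) (g : ℕ → ℕ) : Prop :=
  ∃ Zs, CompApprox Zs Z ∧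
    ∀ n, (changeStages Zs n).Finite ∧ (changeStages Zs n).ncard ≤ g n

/-- `Z` is ω-c.a.: a `g`-change set for some computable `g`. -/
def OmegaCA (Z : ℕ → Bool) : Prop := ∃ g : ℕ → ℕ, Computable g ∧ GChangeSet Z g

/-- Lexicographic order on Cantor space. -/
def LexLE (X Y : ℕ → Bool) : Prop :=
  X = Y ∨ ∃ n, (∀ i, i < n → X i = Y i) ∧ X n = false ∧ Y n = true

/-- `Z` is left-c.e. -/
def LeftCE (Z : ℕ → Bool) : Prop :=
  ∃ Zs, CompApprox Zs Z ∧ ∀ s, LexLE (Zs s) (Zs (s + 1))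

/-- `c` is a cost function: computable, nonnegative, nondecreasing in the stage,
nonincreasing in the number. -/
def CostFunction (c : ℕ → ℕ → ℚ) : Prop :=
  Computable₂ c ∧ (∀ x s, 0 ≤ c x s) ∧
    (∀ x s t, s ≤ t → c x s ≤ c x t) ∧ (∀ x y s, x ≤ y → c y s ≤ c x s)

/-- The limit condition for a cost function. -/
def LimitCondition (c : ℕ → ℕ → ℚ) : Prop :=
  ∀ ε : ℚ, 0 < ε → ∃ x₀, ∀ x, x₀ ≤ x → ∀ s, c x s ≤ ε

/-- A benign cost function: the number of pairwise disjoint intervals `[x,s)` with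
`c x s ≥ 2^{-k}` is computably bounded in `k`. -/
def Benign (c : ℕ → ℕ → ℚ) : Prop :=
  ∃ b : ℕ → ℕ, Computable b ∧
    ∀ k m (x s : ℕ → ℕ), (∀ i, i < m → x i < s i) →
      (∀ i, i + 1 < m → s i ≤ x (i + 1)) →
      (∀ i, i < m → ((1 : ℚ) / 2) ^ k ≤ c (x i) (s i)) → m ≤ b k

open Classical in
/-- The cost paid at stage `s` by the approximation `As`: if `s ≥ 1` and the
approximation changes at `s`, it is `c x s` where `x` is the least changed number. -/
noncomputable def stageCost (c : ℕ → ℕ → ℚ) (As : ℕ → ℕ → Bool) (s : ℕ) : ℚ :=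
  if s = 0 then 0
  else if h : ∃ x, As s x ≠ As (s - 1) x then c (Nat.find h) s else 0

/-- `A` obeys the cost function `c`: some computable approximation of `A` has
finite total cost. -/
def Obeys (A : ℕ → Bool) (c : ℕ → ℕ → ℚ) : Prop :=
  ∃ As, CompApprox As A ∧ ∃ B : ℚ, ∀ F : Finset ℕ, ∑ s ∈ F, stageCost c As s ≤ B

/-- Functions partial recursive in the oracle `O`. -/
inductive RecIn (O : ℕ →. ℕ) : (ℕ →. ℕ) → Prop
  | oracle : RecIn O O
  | zero : RecIn O (pure 0)
  | succ : RecIn O ↑Nat.succ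
  | left : RecIn O ↑fun n : ℕ => n.unpair.1
  | right : RecIn O ↑fun n : ℕ => n.unpair.2
  | pair {f g} : RecIn O f → RecIn O g → RecIn O fun n => Nat.pair <$> f n <*> g n
  | comp {f g} : RecIn O f → RecIn O g → RecIn O fun n => g n >>= f
  | prec {f g} : RecIn O f → RecIn O g → RecIn O (Nat.unpaired fun a n =>
      n.rec (f a) fun y IH => do let i ← IH; g (Nat.pair a (Nat.pair y i)))
  | rfind {f} : RecIn O f → RecIn O fun a =>
      Nat.rfind fun n => (fun m => m = 0) <$> f (Nat.pair a n)

/-- The characteristic function of `A` as a partial function ℕ →. ℕ. -/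
def charFn (A : ℕ → Bool) : ℕ →. ℕ := fun n => Part.some (cond (A n) 1 0)

/-- Turing reducibility: `A ≤_T Z`. -/
def TuringLE (A Z : ℕ → Bool) : Prop := RecIn (charFn Z) (charFn A)

/-- `A` is computably enumerable: the domain of a partial computable function. -/
def CE (A : ℕ → Bool) : Prop :=
  ∃ f : ℕ →. ℕ, Nat.Partrec f ∧ ∀ x, A x = true ↔ (f x).Dom

/-- A Π⁰₁ class of elements of Cantor space. -/
def Pi01 (P : Set (ℕ → Bool)) : Prop :=
  ∃ f : ℕ → Option (List Bool), Computable f ∧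
    P = {Z | ∀ i σ, f i = some σ → ¬ InitSeg σ Z}

/-- The c.e. set `W_e`: the domain of the `e`-th partial computable function. -/
def Wset (e : ℕ) : Set ℕ :=
  {x | ((Denumerable.ofNat Nat.Partrec.Code e).eval x).Dom}

/-- The stage-`s` approximation to `W_e`, via step-bounded evaluation. -/
def WAt (e s x : ℕ) : Prop :=
  (Nat.Partrec.Code.evaln s (Denumerable.ofNat Nat.Partrec.Code e) x).isSome

/-- `A` is promptly simple. -/
def PromptlySimple (A : ℕ → Bool) : Prop :=
  CE A ∧ {x | A x = false}.Infinite ∧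
    ∃ As : ℕ → ℕ → Bool, Computable₂ As ∧
      (∀ s x, As s x = true → As (s + 1) x = true) ∧
      (∀ x, A x = true ↔ ∃ s, As s x = true) ∧
      ∀ e, (Wset e).Infinite →
        ∃ s x, 1 ≤ s ∧ WAt e s x ∧ ¬ WAt e (s - 1) x ∧ As s x = true

def ball (p : ℕ → Bool) (n : ℕ) : Bool := Nat.rec true (fun i b => b && p i) n

theorem ball_iff (p : ℕ → Bool) (n : ℕ) : ball p n = true ↔ ∀ i < n, p i = true := by
  induction n with
  | zero => simp [ball]
  | succ n ih =>
    have : ball p (n+1) = (ball p n && p n) := rfl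
    rw [this, Bool.and_eq_true, ih]
    constructor
    · rintro ⟨h1, h2⟩ i hi
      rcases Nat.lt_succ_iff_lt_or_eq.1 hi with h | rfl
      · exact h1 i h
      · exact h2
    · intro h
      exact ⟨fun i hi => h i (by omega), h n (by omega)⟩

theorem computable_ball {α : Type*} [Primcodable α] {p : α → ℕ → Bool} {f : α → ℕ}
    (hp : Computable₂ p) (hf : Computable f) : Computable fun a => ball (p a) (f a) := by
  unfold ball
  refine Computable.nat_rec (h := fun a (q : ℕ × Bool) => q.2 && p a q.1) hf (Computable.const true) ?_
  refine Primrec.and.to_comp.comp (Computable.snd.comp Computable.snd) ?_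
  exact hp.comp Computable.fst (Computable.fst.comp Computable.snd)

theorem restr_succ (Z : ℕ → Bool) (n : ℕ) : restr Z (n+1) = restr Z n ++ [Z n] := by
  simp [restr, List.range_succ]

theorem restr_eq_rec (Z : ℕ → Bool) (n : ℕ) :
    restr Z n = Nat.rec [] (fun i l => l ++ [Z i]) n := by
  induction n with
  | zero => rfl
  | succ n ih => rw [restr_succ, ih]

theorem computable_restr {Zs : ℕ → ℕ → Bool} (h : Computable₂ Zs) :
    Computable₂ fun t e => restr (Zs t) e := by
  have : Computable fun a : ℕ × ℕ => (Nat.rec [] (fun i l => l ++ [Zs a.1 i]) a.2 : List Bool) := by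
    refine Computable.nat_rec (h := fun (a : ℕ × ℕ) (q : ℕ × List Bool) => q.2 ++ [Zs a.1 q.1])
      Computable.snd (Computable.const []) ?_
    refine Computable.list_concat.comp (Computable.snd.comp Computable.snd) ?_
    exact h.comp (Computable.fst.comp Computable.fst) (Computable.fst.comp Computable.snd)
  exact this.of_eq fun a => (restr_eq_rec _ _).symm

theorem computable_deq {α β : Type*} [Primcodable α] [Primcodable β] [DecidableEq β] {f g : α → β}
    (hf : Computable f) (hg : Computable g) : Computable fun a => decide (f a = g a) := by
  exact (Primrec.eq.decide.to_comp).comp hf hg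

def Pb (Zs : ℕ → ℕ → Bool) (e k : ℕ) : Bool :=
  decide (Nat.Partrec.Code.evaln k.unpair.2 (Denumerable.ofNat Nat.Partrec.Code e)
    (Nat.pair e k.unpair.1) = some 0) &&
  ball (fun t => decide (t < k.unpair.1) ||
    decide (restr (Zs t) e = restr (Zs k.unpair.1) e)) (k.unpair.2 + 1)

def Qb (Zs : ℕ → ℕ → Bool) (e k : ℕ) : Bool := Pb Zs e k && ball (fun j => !Pb Zs e j) k

theorem Pb_iff (Zs : ℕ → ℕ → Bool) (e n s : ℕ) : Pb Zs e (Nat.pair n s) = true ↔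
    Nat.Partrec.Code.evaln s (Denumerable.ofNat Nat.Partrec.Code e) (Nat.pair e n) = some 0 ∧
    ∀ t, n ≤ t → t ≤ s → restr (Zs t) e = restr (Zs n) e := by
  simp only [Pb, Nat.unpair_pair, Bool.and_eq_true, decide_eq_true_eq, ball_iff, Bool.or_eq_true]
  refine and_congr_right fun _ => ?_
  constructor
  · intro h t h1 h2
    exact (h t (by omega)).resolve_left (by omega)
  · intro h t h1
    by_cases h2 : t < n
    · exact Or.inl h2
    · exact Or.inr (h t (by omega) (by omega))

theorem Qb_iff (Zs : ℕ → ℕ → Bool) (e k : ℕ) : Qb Zs e k = true ↔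
    Pb Zs e k = true ∧ ∀ j < k, Pb Zs e j ≠ true := by
  simp [Qb, ball_iff]

theorem Qb_unique {Zs : ℕ → ℕ → Bool} {e k l : ℕ} (hk : Qb Zs e k = true)
    (hl : Qb Zs e l = true) : k = l := by
  rw [Qb_iff] at hk hl
  rcases lt_trichotomy k l with h | h | h
  · exact absurd hk.1 (hl.2 _ h)
  · exact h
  · exact absurd hl.1 (hk.2 _ h)

theorem computable_Pb {Zs : ℕ → ℕ → Bool} (h : Computable₂ Zs) : Computable₂ (Pb Zs) := by
  have hu1 : Computable fun k : ℕ => k.unpair.1 := Computable.fst.comp Computable.unpair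
  have hu2 : Computable fun k : ℕ => k.unpair.2 := Computable.snd.comp Computable.unpair
  have hR := computable_restr h
  have h1 : Computable fun a : ℕ × ℕ => decide (Nat.Partrec.Code.evaln a.2.unpair.2
      (Denumerable.ofNat Nat.Partrec.Code a.1) (Nat.pair a.1 a.2.unpair.1) = some 0) := by
    refine computable_deq ?_ (Computable.const _)
    refine Nat.Partrec.Code.primrec_evaln.to_comp.comp
      (((hu2.comp Computable.snd).pair ((Computable.ofNat _).comp Computable.fst)).pair ?_)
    exact Primrec₂.natPair.to_comp.comp Computable.fst (hu1.comp Computable.snd)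
  have h2 : Computable fun a : ℕ × ℕ => ball (fun t => decide (t < a.2.unpair.1) ||
      decide (restr (Zs t) a.1 = restr (Zs a.2.unpair.1) a.1)) (a.2.unpair.2 + 1) := by
    refine computable_ball (p := fun (a : ℕ × ℕ) (t : ℕ) => decide (t < a.2.unpair.1) ||
      decide (restr (Zs t) a.1 = restr (Zs a.2.unpair.1) a.1)) ?_
      (Computable.succ.comp (hu2.comp Computable.snd))
    have hn : Computable fun a : (ℕ × ℕ) × ℕ => a.1.2.unpair.1 :=
      hu1.comp (Computable.snd.comp Computable.fst)
    have he : Computable fun a : (ℕ × ℕ) × ℕ => a.1.1 := Computable.fst.comp Computable.fst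
    refine Primrec.or.to_comp.comp ?_ ?_
    · exact (Primrec.nat_lt.decide.to_comp).comp Computable.snd hn
    · exact computable_deq (hR.comp Computable.snd he) (hR.comp hn he)
  exact Primrec.and.to_comp.comp h1 h2

theorem computable_Qb {Zs : ℕ → ℕ → Bool} (h : Computable₂ Zs) : Computable₂ (Qb Zs) := by
  have hP := computable_Pb h
  refine Primrec.and.to_comp.comp hP ?_
  refine computable_ball (p := fun (a : ℕ × ℕ) (j : ℕ) => !Pb Zs a.1 j) ?_ Computable.snd
  exact Primrec.not.to_comp.comp (hP.comp (Computable.fst.comp Computable.fst) Computable.snd)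

theorem RecIn.of_partrec {O f : ℕ →. ℕ} (h : Nat.Partrec f) : RecIn O f := by
  induction h with
  | zero => exact .zero
  | succ => exact .succ
  | left => exact .left
  | right => exact .right
  | pair _ _ ih₁ ih₂ => exact .pair ih₁ ih₂
  | comp _ _ ih₁ ih₂ => exact .comp ih₁ ih₂
  | prec _ _ ih₁ ih₂ => exact .prec ih₁ ih₂
  | rfind _ ih => exact .rfind ih

theorem RecIn.of_eq {O f g : ℕ →. ℕ} (h : RecIn O f) (H : ∀ n, f n = g n) : RecIn O g :=
  (funext H : f = g) ▸ h

theorem RecIn.of_comp {O : ℕ →. ℕ} {f : ℕ → ℕ} (h : Computable f) :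
    RecIn O (fun n => Part.some (f n)) :=
  RecIn.of_partrec (Partrec.nat_iff.1 h)

theorem approx_restr {Zs : ℕ → ℕ → Bool} {Z : ℕ → Bool} (h : Approx Zs Z) (e : ℕ) :
    ∃ t, ∀ s, t ≤ s → restr (Zs s) e = restr Z e := by
  induction e with
  | zero => exact ⟨0, fun s _ => rfl⟩
  | succ e ih =>
    obtain ⟨t, ht⟩ := ih
    obtain ⟨u, hu⟩ := h e
    refine ⟨max t u, fun s hs => ?_⟩
    rw [restr_succ, restr_succ, ht s (by omega), hu s (by omega)]

open Classical in
noncomputable def Aset (Zs : ℕ → ℕ → Bool) (x : ℕ) : Bool :=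
  decide (∃ s, Qb Zs x.unpair.1 (Nat.pair x.unpair.2 s) = true)

theorem Aset_iff (Zs : ℕ → ℕ → Bool) (x : ℕ) : Aset Zs x = true ↔
    ∃ s, Qb Zs x.unpair.1 (Nat.pair x.unpair.2 s) = true := by
  simp [Aset]

theorem computable_Qx {Zs : ℕ → ℕ → Bool} (h : Computable₂ Zs) :
    Computable₂ fun x s : ℕ => Qb Zs x.unpair.1 (Nat.pair x.unpair.2 s) := by
  have hu1 : Computable fun k : ℕ => k.unpair.1 := Computable.fst.comp Computable.unpair
  have hu2 : Computable fun k : ℕ => k.unpair.2 := Computable.snd.comp Computable.unpair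
  exact (computable_Qb h).comp (hu1.comp Computable.fst)
    (Primrec₂.natPair.to_comp.comp (hu2.comp Computable.fst) Computable.snd)

theorem rfind_some_dom (p : ℕ → Bool) :
    (Nat.rfind (fun s => Part.some (p s) : ℕ →. Bool)).Dom ↔ ∃ s, p s = true := by
  refine Nat.rfind_dom.trans ?_
  constructor
  · rintro ⟨s, hs, -⟩
    exact ⟨s, ((Part.mem_some_iff.1 hs)).symm⟩
  · rintro ⟨s, hs⟩
    exact ⟨s, Part.mem_some_iff.2 hs.symm, fun _ => trivial⟩

theorem Aset_ce {Zs : ℕ → ℕ → Bool} (h : Computable₂ Zs) : CE (Aset Zs) := by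
  refine ⟨fun x => Nat.rfind fun s => Part.some (Qb Zs x.unpair.1 (Nat.pair x.unpair.2 s)),
    Partrec.nat_iff.1 (Partrec.rfind (computable_Qx h).partrec₂), fun x => ?_⟩
  exact (Aset_iff Zs x).trans (rfind_some_dom _).symm

theorem Aset_not_computable {Zs : ℕ → ℕ → Bool} {Z : ℕ → Bool} (h : Approx Zs Z) :
    ¬ Computable (Aset Zs) := by
  intro hc
  obtain ⟨c, hc⟩ := Nat.Partrec.Code.exists_code.1 hc
  have hev : ∀ x, c.eval x = Part.some (Encodable.encode (Aset Zs x)) := by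
    intro x
    rw [hc]; simp
  set e := Encodable.encode c with he
  have hce : Denumerable.ofNat Nat.Partrec.Code e = c := Denumerable.ofNat_encode c
  by_cases hP : ∃ k, Pb Zs e k = true
  · have hQ : Qb Zs e (Nat.find hP) = true :=
      (Qb_iff _ _ _).2 ⟨Nat.find_spec hP, fun j hj => Nat.find_min hP hj⟩
    obtain ⟨n, s, hns⟩ : ∃ n s, Nat.find hP = Nat.pair n s := ⟨_, _, (Nat.pair_unpair _).symm⟩
    have h1 := Nat.find_spec hP
    rw [hns, Pb_iff, hce] at h1
    have h2 := Nat.Partrec.Code.evaln_sound h1.1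
    rw [hev] at h2
    have h3 : Aset Zs (Nat.pair e n) = true := by
      rw [Aset_iff]; exact ⟨s, by simpa [← hns] using hQ⟩
    rw [h3] at h2
    simp at h2
  · obtain ⟨t, ht⟩ := approx_restr h e
    have h3 : Aset Zs (Nat.pair e t) = false := by
      rw [← Bool.not_eq_true, Aset_iff]
      rintro ⟨s, hs⟩
      rw [Nat.unpair_pair] at hs
      exact hP ⟨_, ((Qb_iff _ _ _).1 hs).1⟩
    have h4 : 0 ∈ c.eval (Nat.pair e t) := by rw [hev, h3]; simp
    obtain ⟨s, hs⟩ := Nat.Partrec.Code.evaln_complete.1 h4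
    refine hP ⟨Nat.pair t s, (Pb_iff _ _ _ _).2 ⟨by rw [hce]; exact hs, fun u hu _ => ?_⟩⟩
    rw [ht u hu, ht t le_rfl]

/-- The Solovay test. -/
def test (Zs : ℕ → ℕ → Bool) (i : ℕ) : List Bool :=
  cond (Qb Zs i.unpair.1 i.unpair.2) (restr (Zs i.unpair.2.unpair.1) i.unpair.1)
    (restr (fun _ => true) i)

theorem computable_test {Zs : ℕ → ℕ → Bool} (h : Computable₂ Zs) : Computable (test Zs) := by
  have hu1 : Computable fun k : ℕ => k.unpair.1 := Computable.fst.comp Computable.unpair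
  have hu2 : Computable fun k : ℕ => k.unpair.2 := Computable.snd.comp Computable.unpair
  refine Computable.cond ((computable_Qb h).comp hu1 hu2)
    ((computable_restr h).comp (hu1.comp hu2) hu1) ?_
  exact (computable_restr (Zs := fun _ _ => true) (Computable.const true)).comp
    (Computable.const 0) Computable.id

theorem restr_length (Z : ℕ → Bool) (n : ℕ) : (restr Z n).length = n := by simp [restr]

theorem summable_test (Zs : ℕ → ℕ → Bool) :
    Summable (fun i => ((1 : ℝ) / 2) ^ (test Zs i).length) := by
  have hg : Summable fun i : ℕ => ((1 : ℝ) / 2) ^ i := summable_geometric_two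
  let S : Set ℕ := {i | Qb Zs i.unpair.1 i.unpair.2 = true}
  have hinj : Function.Injective fun i : S => (i : ℕ).unpair.1 := by
    rintro ⟨i, hi⟩ ⟨j, hj⟩ hij
    simp only [S, Set.mem_ofPred_eq] at hi hj hij
    rw [hij] at hi
    have := Qb_unique hi hj
    apply Subtype.ext
    change i = j
    rw [← Nat.pair_unpair i, ← Nat.pair_unpair j, hij, this]
  have h1 : Summable (S.indicator fun i : ℕ => ((1 : ℝ) / 2) ^ i.unpair.1) :=
    summable_subtype_iff_indicator.1 (hg.comp_injective hinj)
  refine Summable.of_nonneg_of_le (fun i => by positivity) (fun i => ?_) (h1.add hg)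
  by_cases hi : i ∈ S
  · rw [Set.indicator_of_mem hi]
    have hi' : Qb Zs i.unpair.1 i.unpair.2 = true := hi
    simp only [test, hi', cond_true, restr_length]
    have : (0 : ℝ) ≤ (1 / 2) ^ i := by positivity
    linarith
  · rw [Set.indicator_of_notMem hi]
    have hi' : Qb Zs i.unpair.1 i.unpair.2 = false := by simpa [S] using hi
    simp only [test, hi', cond_false, restr_length, zero_add, le_refl]

theorem exists_bound {Zs : ℕ → ℕ → Bool} {Z : ℕ → Bool} (hrand : MLRandom Z)
    (h : Computable₂ Zs) : ∃ M, ∀ e n s, Qb Zs e (Nat.pair n s) = true →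
      restr (Zs n) e = restr Z e → s ≤ M := by
  obtain ⟨M, hM⟩ := (hrand _ (computable_test h) (summable_test Zs)).bddAbove
  refine ⟨M, fun e n s hQ hr => ?_⟩
  have hmem : Nat.pair e (Nat.pair n s) ∈ {i | InitSeg (test Zs i) Z} := by
    simp only [Set.mem_ofPred_eq, InitSeg, test, Nat.unpair_pair, hQ, cond_true, restr_length, hr]
  exact ((Nat.right_le_pair n s).trans (Nat.right_le_pair e _)).trans (hM hmem)

theorem Aset_le {Zs : ℕ → ℕ → Bool} {Z : ℕ → Bool} (hrand : MLRandom Z)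
    (h : CompApprox Zs Z) : TuringLE (Aset Zs) Z := by
  obtain ⟨M, hM⟩ := exists_bound hrand h.1
  have hu1 : Computable fun k : ℕ => k.unpair.1 := Computable.fst.comp Computable.unpair
  have hu2 : Computable fun k : ℕ => k.unpair.2 := Computable.snd.comp Computable.unpair
  -- the decision procedure given the right initial segment of the oracle
  let F : ℕ × List Bool →. ℕ := fun a =>
    (Nat.rfind fun u => Part.some
      (decide (restr (Zs (u + (a.1.unpair.2 + M))) a.1.unpair.1 = a.2))).map fun u =>
      cond (ball (fun s => !Qb Zs a.1.unpair.1 (Nat.pair a.1.unpair.2 s))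
        (u + (a.1.unpair.2 + M) + 1)) 0 1
  have hF : Partrec F := by
    have hx : Computable fun a : (ℕ × List Bool) × ℕ => a.1.1 := Computable.fst.comp Computable.fst
    have hsum : Computable fun a : (ℕ × List Bool) × ℕ => a.2 + (a.1.1.unpair.2 + M) :=
      Primrec.nat_add.to_comp.comp Computable.snd
        (Primrec.nat_add.to_comp.comp (hu2.comp hx) (Computable.const M))
    refine Partrec.map (Partrec.rfind (Computable₂.partrec₂ ?_)) ?_
    · exact computable_deq ((computable_restr h.1).comp hsum (hu1.comp hx))
        (Computable.snd.comp Computable.fst)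
    · refine Computable.cond ?_ (Computable.const 0) (Computable.const 1)
      refine computable_ball (p := fun (a : (ℕ × List Bool) × ℕ) s =>
        !Qb Zs a.1.1.unpair.1 (Nat.pair a.1.1.unpair.2 s)) ?_ (Computable.succ.comp hsum)
      exact Primrec.not.to_comp.comp ((computable_Qx h.1).comp (hx.comp Computable.fst)
        Computable.snd)
  have hFs : ∀ x, F (x, restr Z x.unpair.1) = Part.some (cond (Aset Zs x) 1 0) := by
    intro x
    obtain ⟨t, ht⟩ := approx_restr h.2 x.unpair.1
    have hdom : (Nat.rfind fun u => Part.some (decide (restr (Zs (u + (x.unpair.2 + M)))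
        x.unpair.1 = restr Z x.unpair.1))).Dom := by
      refine (rfind_some_dom _).2 ⟨t, ?_⟩
      simp [ht (t + (x.unpair.2 + M)) (by omega)]
    obtain ⟨u, hu⟩ := Part.dom_iff_mem.1 hdom
    have hu' := Nat.rfind_spec hu
    simp only [Part.mem_some_iff] at hu'
    have hu2 := of_decide_eq_true hu'.symm
    simp only [F]
    rw [Part.eq_some_iff.2 hu, Part.map_some]
    congr 1
    cases hA : Aset Zs x with
    | true =>
      obtain ⟨s, hs⟩ := (Aset_iff _ _).1 hA
      have hle : s < u + (x.unpair.2 + M) + 1 := by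
        by_contra hlt
        have h1 := ((Pb_iff _ _ _ _).1 ((Qb_iff _ _ _).1 hs).1).2 (u + (x.unpair.2 + M))
          (by omega) (by omega)
        have := hM _ _ _ hs (h1.symm.trans hu2)
        omega
      have : ball (fun s => !Qb Zs x.unpair.1 (Nat.pair x.unpair.2 s))
          (u + (x.unpair.2 + M) + 1) = false := by
        rw [← Bool.not_eq_true, ball_iff]
        intro hh
        have := hh s hle
        simp [hs] at this
      rw [this]; rfl
    | false =>
      have : ball (fun s => !Qb Zs x.unpair.1 (Nat.pair x.unpair.2 s))
          (u + (x.unpair.2 + M) + 1) = true := by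
        rw [ball_iff]
        intro s _
        by_contra hs
        have : Aset Zs x = true := (Aset_iff _ _).2 ⟨s, by simpa using hs⟩
        rw [hA] at this; cases this
      rw [this]; rfl
  -- the initial segment of the oracle
  let app : ℕ → ℕ := fun p => Encodable.encode
    ((((Encodable.decode (α := List Bool) p.unpair.1).getD []) ++ [decide (p.unpair.2 = 1)]))
  have happ : Computable app := by
    refine Computable.encode.comp (Computable.list_concat.comp ?_
      (computable_deq hu2 (Computable.const 1)))
    exact Computable.option_getD (Computable.decode.comp hu1) (Computable.const [])
  have hstep : RecIn (charFn Z) fun p => Part.some (app (Nat.pair p.unpair.2.unpair.2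
      (cond (Z p.unpair.2.unpair.1) 1 0))) := by
    have h1 : RecIn (charFn Z) fun p => Part.some p.unpair.2.unpair.2 :=
      RecIn.of_comp (hu2.comp hu2)
    have h2 := RecIn.comp (O := charFn Z) RecIn.oracle (RecIn.of_comp (hu1.comp hu2))
    have h3 := RecIn.comp (RecIn.of_comp happ) (RecIn.pair h1 h2)
    refine h3.of_eq fun p => ?_
    have h4 : (Part.some p.unpair.2.unpair.1 >>= charFn Z) =
        Part.some (cond (Z p.unpair.2.unpair.1) 1 0) := Part.bind_some _ _
    simp only [h4]
    simp [Seq.seq]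
  have hseg : RecIn (charFn Z) fun x => Part.some (Encodable.encode (restr Z x.unpair.1)) := by
    have h1 := RecIn.prec (RecIn.of_comp (O := charFn Z)
      (Computable.const (Encodable.encode ([] : List Bool)))) hstep
    have h2 := RecIn.comp h1 (RecIn.of_comp (f := fun x => Nat.pair 0 x.unpair.1)
      (Primrec₂.natPair.to_comp.comp (Computable.const 0) hu1))
    refine h2.of_eq fun x => ?_
    simp only [Part.bind_eq_bind, Part.bind_some, Nat.unpaired, Nat.unpair_pair]
    induction x.unpair.1 with
    | zero => rfl
    | succ n ih =>
      simp only []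
      rw [ih]
      simp only [Part.bind_some, app, Nat.unpair_pair, Encodable.encodek, Option.getD_some,
        restr_succ]
      cases Z n <;> simp
  have h1 : RecIn (charFn Z) fun x => Part.some x := RecIn.of_comp Computable.id
  have h2 := RecIn.comp (RecIn.of_partrec hF) (RecIn.pair h1 hseg)
  unfold TuringLE
  refine h2.of_eq fun x => ?_
  have h3 : (Nat.pair <$> Part.some x <*> Part.some (Encodable.encode (restr Z x.unpair.1)))
      = Part.some (Encodable.encode (x, restr Z x.unpair.1)) := by
    simp [Seq.seq]
  rw [h3]
  simp only [Part.bind_eq_bind, Part.bind_some, Encodable.encodek, Part.coe_some, hFs]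
  simp [charFn]

/-- Kučera: Every ML-random Δ⁰₂ set computes an incomputable
c.e. set. -/
theorem kucera (Z : ℕ → Bool) (hrand : MLRandom Z) (hZ : Delta02 Z) :
    ∃ A : ℕ → Bool, CE A ∧ ¬ Computable A ∧ TuringLE A Z := by
  obtain ⟨Zs, hZs⟩ := hZ
  exact ⟨Aset Zs, Aset_ce hZs.1, Aset_not_computable hZs.2, Aset_le hrand hZs⟩
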